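/- arXiv:1405.6856 — 2 statements merged into one kernel-verified Lean document; each statement's English description precedes it below -/
import Mathlib

section
/- Let μ > 0, let n be the integer with n−1 ≤ μ < n, and set σ = n−μ. Define the left fractional derivative D^μ u(x) = (1/Γ(σ)) (d^n/dx^n) ∫_{−∞}^x (x−ξ)^{σ−1} u(ξ) dξ and the right fractional derivative D^{μ*} u(x) = ((−1)^n/Γ(σ)) (d^n/dx^n) ∫_x^{∞} (ξ−x)^{σ−1} u(ξ) dξ. Then for every real-valued smooth compactly supported function u on ℝ one has ‖D^μ u‖_{L²(ℝ)} = ‖D^{μ*} u‖_{L²(ℝ)}. (Equality of the left and right fractional derivative semi-norms on C₀^∞(ℝ).) -/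
open MeasureTheory

/-- The `L²(ℝ)` norm `(∫ |u(x)|² dx)^{1/2}`. -/
noncomputable def L2normR (u : ℝ → ℝ) : ℝ :=
  (∫ x : ℝ, (u x) ^ 2) ^ ((1:ℝ)/2)

/-- The left fractional derivative of order `μ` (with `n-1 ≤ μ < n`, `σ = n-μ`):
`D^μ u(x) = (1/Γ(σ)) (d/dx)^n ∫_{-∞}^x (x-ξ)^{σ-1} u(ξ) dξ`. -/
noncomputable def leftFracDeriv (μ : ℝ) (n : ℕ) (u : ℝ → ℝ) : ℝ → ℝ :=
  iteratedDeriv n (fun x =>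
    (1 / Real.Gamma ((n : ℝ) - μ)) * ∫ t in Set.Iic x, (x - t) ^ ((n : ℝ) - μ - 1) * u t)

/-- The right fractional derivative of order `μ` (with `n-1 ≤ μ < n`, `σ = n-μ`):
`D^{μ*} u(x) = ((-1)^n/Γ(σ)) (d/dx)^n ∫_x^∞ (ξ-x)^{σ-1} u(ξ) dξ`. -/
noncomputable def rightFracDeriv (μ : ℝ) (n : ℕ) (u : ℝ → ℝ) : ℝ → ℝ :=
  fun x => (-1 : ℝ) ^ n * iteratedDeriv n (fun y =>
    (1 / Real.Gamma ((n : ℝ) - μ)) * ∫ t in Set.Ici y, (t - y) ^ ((n : ℝ) - μ - 1) * u t) x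

open scoped Convolution
open Set Filter Topology
open ContinuousLinearMap (mul)

/-- The exponentially damped power kernel `s ↦ s₊^p e^{-εs}`. -/
noncomputable def dampedPower (p ε : ℝ) : ℝ → ℝ :=
  (Ioi 0).indicator fun s => s ^ p * Real.exp (-(ε * s))

section DampedPower

variable {p ε : ℝ}

theorem dampedPower_of_pos {s : ℝ} (hs : 0 < s) :
    dampedPower p ε s = s ^ p * Real.exp (-(ε * s)) :=
  indicator_of_mem (mem_Ioi.2 hs) _

theorem dampedPower_of_nonpos {s : ℝ} (hs : s ≤ 0) : dampedPower p ε s = 0 :=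
  indicator_of_notMem (notMem_Ioi.2 hs) _

theorem measurable_dampedPower : Measurable (dampedPower p ε) := by
  refine Measurable.indicator ?_ measurableSet_Ioi
  fun_prop

theorem dampedPower_zero_nonneg (s : ℝ) : 0 ≤ dampedPower p 0 s := by
  rcases le_or_gt s 0 with hs | hs
  · rw [dampedPower_of_nonpos hs]
  · rw [dampedPower_of_pos hs]; positivity

theorem abs_dampedPower_le (hε : 0 ≤ ε) (s : ℝ) : |dampedPower p ε s| ≤ dampedPower p 0 s := by
  rcases le_or_gt s 0 with hs | hs
  · simp [dampedPower_of_nonpos hs]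
  · rw [dampedPower_of_pos hs, dampedPower_of_pos hs, abs_of_nonneg (by positivity)]
    gcongr

theorem locallyIntegrable_dampedPower (hp : -1 < p) (hε : 0 ≤ ε) :
    LocallyIntegrable (dampedPower p ε) := by
  refine locallyIntegrable_of_norm_le_rpow (C := 1) (α := -p) (by simp) (by simp; linarith)
    (ae_of_all _ fun s => ?_) measurable_dampedPower.aestronglyMeasurable
  refine (abs_dampedPower_le hε s).trans ?_
  rcases le_or_gt s 0 with hs | hs
  · rw [dampedPower_of_nonpos hs]; positivity
  · simp [dampedPower_of_pos hs, abs_of_pos hs]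

theorem integrable_dampedPower (hp : -1 < p) (hε : 0 < ε) : Integrable (dampedPower p ε) := by
  rw [dampedPower, integrable_indicator_iff measurableSet_Ioi]
  simpa using integrableOn_rpow_mul_exp_neg_mul_rpow hp one_pos hε

theorem tendsto_dampedPower (p s : ℝ) :
    Tendsto (fun ε => dampedPower p ε s) (𝓝 0) (𝓝 (dampedPower p 0 s)) := by
  refine Continuous.tendsto (f := fun ε => dampedPower p ε s) ?_ 0
  rcases le_or_gt s 0 with hs | hs
  · simp_rw [dampedPower_of_nonpos hs]; fun_prop
  · simp_rw [dampedPower_of_pos hs]; fun_prop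

theorem abs_dampedPower_sub_le_of_le (hp : -1 < p) (hp0 : p ≤ 0) (hε : 0 ≤ ε) {a b : ℝ}
    (ha : 1 ≤ a) (hab : a ≤ b) :
    |dampedPower p ε a - dampedPower p ε b| ≤ 2 * (b - a) / a := by
  have ha0 : 0 < a := by linarith
  have hb0 : 0 < b := by linarith
  rw [dampedPower_of_pos ha0, dampedPower_of_pos hb0]
  have hap : a ^ p ≤ 1 := Real.rpow_le_one_of_one_le_of_nonpos ha hp0
  have hap0 : 0 < a ^ p := by positivity
  have hmono : b ^ p ≤ a ^ p := Real.rpow_le_rpow_of_nonpos ha0 hab hp0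
  have hpow : a ^ p - b ^ p ≤ (b - a) / a := by
    have h1 : b ^ p = a ^ p * (b / a) ^ p := by
      rw [← Real.mul_rpow ha0.le (by positivity), mul_div_cancel₀ _ ha0.ne']
    have h2 : (b / a) ^ (-1 : ℝ) ≤ (b / a) ^ p :=
      Real.rpow_le_rpow_of_exponent_le ((one_le_div ha0).2 hab) hp.le
    rw [Real.rpow_neg_one, inv_div] at h2
    have h3 : 1 - a / b ≤ (b - a) / a := by
      rw [one_sub_div hb0.ne']
      exact div_le_div_of_nonneg_left (by linarith) ha0 hab
    have h4 : 0 ≤ 1 - a / b := by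
      rw [one_sub_div hb0.ne']
      exact div_nonneg (by linarith) hb0.le
    rw [h1]
    nlinarith
  have hexp_le : Real.exp (-(ε * b)) ≤ Real.exp (-(ε * a)) := by
    gcongr
  have hexp : Real.exp (-(ε * a)) - Real.exp (-(ε * b)) ≤ (b - a) / a := by
    have h1 : Real.exp (-(ε * b)) = Real.exp (-(ε * a)) * Real.exp (-(ε * (b - a))) := by
      rw [← Real.exp_add]; ring_nf
    have h2 : 1 - ε * (b - a) ≤ Real.exp (-(ε * (b - a))) := Real.one_sub_le_exp_neg _
    have h3 : ε * a * Real.exp (-(ε * a)) ≤ 1 := by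
      have h4 : ε * a ≤ Real.exp (ε * a) := by linarith [Real.add_one_le_exp (ε * a)]
      rw [Real.exp_neg, ← div_eq_mul_inv]
      exact (div_le_one (Real.exp_pos _)).2 h4
    rw [le_div_iff₀ ha0, h1]
    have h5 := (Real.exp_pos (-(ε * a)))
    calc (Real.exp (-(ε * a)) - Real.exp (-(ε * a)) * Real.exp (-(ε * (b - a)))) * a
        = Real.exp (-(ε * a)) * a * (1 - Real.exp (-(ε * (b - a)))) := by ring
      _ ≤ Real.exp (-(ε * a)) * a * (ε * (b - a)) := by gcongr; linarith
      _ = (ε * a * Real.exp (-(ε * a))) * (b - a) := by ring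
      _ ≤ 1 * (b - a) := by gcongr
      _ = b - a := one_mul _
  have hexp1 : Real.exp (-(ε * b)) ≤ 1 := Real.exp_le_one_iff.2 (by nlinarith)
  have hE := Real.exp_pos (-(ε * b))
  rw [abs_of_nonneg (sub_nonneg.2 (by gcongr)), mul_div_assoc]
  have hq : 0 ≤ (b - a) / a := div_nonneg (by linarith) ha0.le
  nlinarith [mul_le_mul_of_nonneg_left hexp hap0.le, mul_le_mul_of_nonneg_right hpow hE.le]

theorem abs_dampedPower_sub_le (hp : -1 < p) (hp0 : p ≤ 0) (hε : 0 ≤ ε) {a b r : ℝ} (hr : 1 ≤ r)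
    (ha : r ≤ a) (hb : r ≤ b) :
    |dampedPower p ε a - dampedPower p ε b| ≤ 2 * |a - b| / r := by
  have hr0 : 0 < r := by linarith
  rcases le_total a b with hab | hab
  · refine (abs_dampedPower_sub_le_of_le hp hp0 hε (hr.trans ha) hab).trans ?_
    rw [abs_sub_comm, abs_of_nonneg (sub_nonneg.2 hab)]
    gcongr
  · rw [abs_sub_comm]
    refine (abs_dampedPower_sub_le_of_le hp hp0 hε (hr.trans hb) hab).trans ?_
    rw [abs_of_nonneg (sub_nonneg.2 hab)]
    gcongr

end DampedPower

theorem integral_convolution_sq {k v : ℝ → ℝ} (hk : Integrable k) (hv : Continuous v)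
    (hvc : HasCompactSupport v) :
    ∫ x, (k ⋆[mul ℝ ℝ] v) x ^ 2 =
      ∫ z : ℝ × ℝ, k z.1 * k z.2 * ∫ x, v (x - z.1) * v (x - z.2) := by
  obtain ⟨C, hC⟩ := hvc.exists_bound_of_continuous hv
  have hvi : Integrable v := hv.integrable_of_hasCompactSupport hvc
  have hkk : Integrable (fun z : ℝ × ℝ => k z.1 * k z.2) := hk.mul_prod hk
  have hmeas : AEStronglyMeasurable
      (fun q : ℝ × (ℝ × ℝ) => k q.2.1 * k q.2.2 * (v (q.1 - q.2.1) * v (q.1 - q.2.2)))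
      (volume.prod volume) := by
    refine AEStronglyMeasurable.mul (hkk.aestronglyMeasurable.comp_snd) ?_
    exact Continuous.aestronglyMeasurable (by fun_prop)
  have hprod (s t : ℝ) : Integrable fun x => v (x - s) * v (x - t) :=
    (hvi.comp_sub_right t).bdd_mul (c := C) (by fun_prop) (ae_of_all _ fun x => hC _)
  have hint : Integrable
      (fun q : ℝ × (ℝ × ℝ) => k q.2.1 * k q.2.2 * (v (q.1 - q.2.1) * v (q.1 - q.2.2)))
      (volume.prod volume) := by
    rw [integrable_prod_iff' hmeas]
    refine ⟨ae_of_all _ fun z => (hprod z.1 z.2).const_mul (k z.1 * k z.2), ?_⟩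
    refine Integrable.mono' (hkk.norm.mul_const (C * ∫ x, ‖v x‖))
      hmeas.norm.prod_swap.integral_prod_right' (ae_of_all _ fun z => ?_)
    simp_rw [norm_mul (k z.1 * k z.2)]
    rw [integral_const_mul, norm_mul, norm_norm]
    gcongr
    rw [Real.norm_of_nonneg (integral_nonneg fun x => norm_nonneg _), ← integral_const_mul,
      ← integral_sub_right_eq_self (fun x => C * ‖v x‖) z.2]
    refine integral_mono (hprod _ _).norm ((hvi.comp_sub_right z.2).norm.const_mul C) fun x => ?_
    simp only [norm_mul]
    gcongr
    exact hC _
  calc ∫ x, (k ⋆[mul ℝ ℝ] v) x ^ 2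
      = ∫ x, ∫ z : ℝ × ℝ, k z.1 * k z.2 * (v (x - z.1) * v (x - z.2)) := by
        congr 1 with x
        rw [sq, convolution_def, Measure.volume_eq_prod]
        simp only [ContinuousLinearMap.mul_apply']
        rw [← integral_prod_mul]
        congr 1 with z
        ring
    _ = ∫ z : ℝ × ℝ, ∫ x, k z.1 * k z.2 * (v (x - z.1) * v (x - z.2)) :=
        integral_integral_swap hint
    _ = _ := by simp_rw [integral_const_mul]

theorem integral_convolution_sq_comp_neg {k v : ℝ → ℝ} (hk : Integrable k) (hv : Continuous v)
    (hvc : HasCompactSupport v) :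
    ∫ x, (k ⋆[mul ℝ ℝ] v) x ^ 2 = ∫ x, (k ⋆[mul ℝ ℝ] fun y => v (-y)) x ^ 2 := by
  rw [integral_convolution_sq hk hv hvc, integral_convolution_sq hk (by fun_prop)
    (by exact hvc.comp_homeomorph (Homeomorph.neg ℝ))]
  congr 1 with z
  rw [← integral_sub_left_eq_self (fun x => v (x - z.1) * v (x - z.2)) volume (z.1 + z.2)]
  congr 2 with x
  ring_nf

theorem exists_convolution_dampedPower_sq_le {p : ℝ} (hp : -1 < p) (hp0 : p ≤ 0) {v : ℝ → ℝ}
    (hv : Continuous v) (hvc : HasCompactSupport v) (hv0 : ∫ x, v x = 0) :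
    ∃ C, ∀ ε, 0 ≤ ε → ∀ x, ((dampedPower p ε ⋆[mul ℝ ℝ] v) x) ^ 2 ≤ C * (1 + x ^ 2)⁻¹ := by
  have hvi : Integrable v := hv.integrable_of_hasCompactSupport hvc
  obtain ⟨M, hM0, hM⟩ : ∃ M, 0 < M ∧ ∀ y, M < |y| → v y = 0 := by
    obtain ⟨M, hM0, hM⟩ := hvc.isCompact.isBounded.exists_pos_norm_lt
    refine ⟨M, hM0, fun y hy => ?_⟩
    by_contra h
    exact lt_asymm hy (hM y (subset_tsupport v h))
  have hcomm {ε : ℝ} (x : ℝ) :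
      (dampedPower p ε ⋆[mul ℝ ℝ] v) x = ∫ t, dampedPower p ε (x - t) * v t := convolution_eq_swap _
  have hexists {ε : ℝ} (hε : 0 ≤ ε) (x : ℝ) :
      Integrable fun t => dampedPower p ε (x - t) * v t :=
    (HasCompactSupport.convolutionExists_right (mul ℝ ℝ) hvc
      (locallyIntegrable_dampedPower hp hε) hv x).integrable_swap
  have hcont : Continuous (dampedPower p 0 ⋆[mul ℝ ℝ] fun y => |v y|) :=
    HasCompactSupport.continuous_convolution_right _ (hvc.comp_left abs_zero)
      (locallyIntegrable_dampedPower hp le_rfl) hv.abs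
  set N := 2 * M + 2
  obtain ⟨B, hB⟩ := (isCompact_Icc (a := -N) (b := N)).exists_bound_of_continuousOn
    hcont.continuousOn
  set D := 4 * M * ∫ y, |v y|
  refine ⟨B ^ 2 * (1 + N ^ 2) + 2 * D ^ 2, fun ε hε x => ?_⟩
  have hD : 0 ≤ D := by positivity
  have hx2 : 0 < 1 + x ^ 2 := by positivity
  rw [← div_eq_mul_inv, le_div_iff₀ hx2, ← sq_abs]
  rcases lt_or_ge x (-N) with hx | hx
  · have : (dampedPower p ε ⋆[mul ℝ ℝ] v) x = 0 := by
      rw [hcomm]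
      refine integral_eq_zero_of_ae (ae_of_all _ fun t => ?_)
      rcases lt_or_ge M |t| with ht | ht
      · simp [hM t ht]
      · have hxt : x - t ≤ 0 := by linarith [(abs_le.1 ht).1]
        simp [dampedPower_of_nonpos hxt]
    rw [this]
    simp only [abs_zero, zero_pow two_ne_zero, zero_mul]
    positivity
  rcases le_or_gt x N with hxN | hxN
  · have hle : |(dampedPower p ε ⋆[mul ℝ ℝ] v) x| ≤ B := by
      refine le_trans ?_ ((le_abs_self _).trans (hB x ⟨hx, hxN⟩))
      rw [hcomm, convolution_eq_swap]
      refine (norm_integral_le_integral_norm _).trans (integral_mono (hexists hε x).norm ?_ ?_)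
      · exact ((hexists le_rfl x).norm).congr (ae_of_all _ fun t => by
          simp [abs_of_nonneg (dampedPower_zero_nonneg _)])
      · intro t
        simp only [norm_mul, Real.norm_eq_abs, ContinuousLinearMap.mul_apply']
        gcongr
        exact abs_dampedPower_le hε _
    have hxsq : x ^ 2 ≤ N ^ 2 := sq_le_sq' hx hxN
    calc |(dampedPower p ε ⋆[mul ℝ ℝ] v) x| ^ 2 * (1 + x ^ 2)
        ≤ B ^ 2 * (1 + N ^ 2) := by gcongr
      _ ≤ _ := by linarith [sq_nonneg D]
  · have hx1 : 1 ≤ x := by linarith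
    have hx0 : 0 < x := by linarith
    have hle : |(dampedPower p ε ⋆[mul ℝ ℝ] v) x| ≤ D / x := by
      have hsub : (dampedPower p ε ⋆[mul ℝ ℝ] v) x =
          ∫ t, (dampedPower p ε (x - t) - dampedPower p ε x) * v t := by
        simp_rw [sub_mul]
        rw [integral_sub (hexists hε x) (hvi.const_mul _), integral_const_mul, hv0, mul_zero,
          sub_zero, hcomm]
      rw [hsub, show D / x = ∫ t, 4 * M / x * |v t| by rw [integral_const_mul]; ring]
      refine norm_integral_le_of_norm_le (f := fun t => _ * v t) (hvi.abs.const_mul (4 * M / x))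
        (ae_of_all _ fun t => ?_)
      rcases lt_or_ge M |t| with ht | ht
      · simp [hM t ht]
      · rw [norm_mul, Real.norm_eq_abs, Real.norm_eq_abs]
        gcongr
        refine (abs_dampedPower_sub_le hp hp0 hε (r := x / 2) (by linarith)
          (by linarith [(abs_le.1 ht).2]) (by linarith)).trans ?_
        rw [sub_sub_cancel_left, abs_neg, div_le_div_iff₀ (by positivity) hx0]
        nlinarith
    calc |(dampedPower p ε ⋆[mul ℝ ℝ] v) x| ^ 2 * (1 + x ^ 2)
        ≤ (D / x) ^ 2 * (2 * x ^ 2) := by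
          gcongr; nlinarith
      _ = 2 * D ^ 2 := by field_simp
      _ ≤ _ := by
        have : 0 ≤ B ^ 2 * (1 + N ^ 2) := by positivity
        linarith

theorem tendsto_integral_convolution_dampedPower_sq {p : ℝ} (hp : -1 < p) (hp0 : p ≤ 0)
    {v : ℝ → ℝ} (hv : Continuous v) (hvc : HasCompactSupport v) (hv0 : ∫ x, v x = 0) :
    Tendsto (fun ε => ∫ x, (dampedPower p ε ⋆[mul ℝ ℝ] v) x ^ 2) (𝓝[>] 0)
      (𝓝 (∫ x, (dampedPower p 0 ⋆[mul ℝ ℝ] v) x ^ 2)) := by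
  obtain ⟨C, hC⟩ := exists_convolution_dampedPower_sq_le hp hp0 hv hvc hv0
  have hpos : ∀ᶠ ε : ℝ in 𝓝[>] 0, 0 < ε := self_mem_nhdsWithin
  have hexists (x : ℝ) := HasCompactSupport.convolutionExists_right (mul ℝ ℝ)
    hvc (locallyIntegrable_dampedPower hp le_rfl) hv x
  refine tendsto_integral_filter_of_dominated_convergence (fun x => C * (1 + x ^ 2)⁻¹) ?_ ?_
    (integrable_inv_one_add_sq.const_mul C) (ae_of_all _ fun x => Tendsto.pow ?_ 2)
  · filter_upwards [hpos] with ε hε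
    exact ((HasCompactSupport.continuous_convolution_right _ hvc
      (locallyIntegrable_dampedPower hp hε.le) hv).pow 2).aestronglyMeasurable
  · filter_upwards [hpos] with ε hε
    refine ae_of_all _ fun x => ?_
    rw [Real.norm_of_nonneg (sq_nonneg _)]
    exact hC ε hε.le x
  · simp only [convolution_def, ContinuousLinearMap.mul_apply']
    refine tendsto_integral_filter_of_dominated_convergence
      (fun s => |dampedPower p 0 s * v (x - s)|) (Eventually.of_forall fun ε => ?_) ?_
      (hexists x).abs (ae_of_all _ fun s => ?_)
    · exact (measurable_dampedPower.mul (hv.measurable.comp (by fun_prop))).aestronglyMeasurable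
    · filter_upwards [hpos] with ε hε
      refine ae_of_all _ fun s => ?_
      rw [norm_mul, abs_mul, abs_of_nonneg (dampedPower_zero_nonneg _)]
      exact mul_le_mul_of_nonneg_right (abs_dampedPower_le hε.le _) (abs_nonneg _)
    · exact ((tendsto_dampedPower p s).mono_left nhdsWithin_le_nhds).mul_const _

theorem integral_convolution_dampedPower_sq_comp_neg {p : ℝ} (hp : -1 < p) (hp0 : p ≤ 0)
    {v : ℝ → ℝ} (hv : Continuous v) (hvc : HasCompactSupport v) (hv0 : ∫ x, v x = 0) :
    ∫ x, (dampedPower p 0 ⋆[mul ℝ ℝ] v) x ^ 2 =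
      ∫ x, (dampedPower p 0 ⋆[mul ℝ ℝ] fun y => v (-y)) x ^ 2 := by
  refine tendsto_nhds_unique (tendsto_integral_convolution_dampedPower_sq hp hp0 hv hvc hv0)
    (Tendsto.congr' ?_ (tendsto_integral_convolution_dampedPower_sq hp hp0 (hv.comp continuous_neg)
      (hvc.comp_homeomorph (Homeomorph.neg ℝ)) ((integral_neg_eq_self v volume).trans hv0)))
  filter_upwards [self_mem_nhdsWithin] with ε hε
  exact (integral_convolution_sq_comp_neg (integrable_dampedPower hp hε) hv hvc).symm

section IteratedDeriv

variable {v : ℝ → ℝ}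

theorem hasCompactSupport_iteratedDeriv (hvc : HasCompactSupport v) (n : ℕ) :
    HasCompactSupport (iteratedDeriv n v) := by
  induction n with
  | zero => simpa using hvc
  | succ n ih => rw [iteratedDeriv_succ]; exact ih.deriv

theorem integral_iteratedDeriv_eq_zero (hv : ContDiff ℝ (⊤ : ℕ∞) v) (hvc : HasCompactSupport v)
    {n : ℕ} (hn : n ≠ 0) : ∫ x, iteratedDeriv n v x = 0 := by
  obtain ⟨m, rfl⟩ := Nat.exists_eq_succ_of_ne_zero hn
  have hcont (j : ℕ) : Continuous (iteratedDeriv j v) :=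
    hv.continuous_iteratedDeriv j (by exact_mod_cast le_top)
  have hint (j : ℕ) : Integrable (iteratedDeriv j v) :=
    (hcont j).integrable_of_hasCompactSupport (hasCompactSupport_iteratedDeriv hvc j)
  have hdiff : Differentiable ℝ (iteratedDeriv m v) :=
    hv.differentiable_iteratedDeriv m (by exact_mod_cast WithTop.coe_lt_top m)
  refine integral_eq_zero_of_hasDerivAt_of_integrable (f := iteratedDeriv m v) (fun x => ?_)
    (hint _) (hint m)
  rw [iteratedDeriv_succ]
  exact (hdiff x).hasDerivAt

theorem iteratedDeriv_convolution {k : ℝ → ℝ} (hk : LocallyIntegrable k)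
    (hv : ContDiff ℝ (⊤ : ℕ∞) v) (hvc : HasCompactSupport v) (n : ℕ) :
    iteratedDeriv n (k ⋆[mul ℝ ℝ] v) = k ⋆[mul ℝ ℝ] iteratedDeriv n v := by
  induction n with
  | zero => simp
  | succ n ih =>
    rw [iteratedDeriv_succ, iteratedDeriv_succ, ih]
    ext x
    have hsmooth : ContDiff ℝ 1 (iteratedDeriv n v) := by
      rw [iteratedDeriv_eq_iterate]
      exact (hv.of_le (by exact_mod_cast le_top)).iterate_deriv' 1 n
    exact (HasCompactSupport.hasDerivAt_convolution_right _ hk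
      (hasCompactSupport_iteratedDeriv hvc n) hsmooth x).deriv

end IteratedDeriv

theorem leftFracDeriv_eq_convolution {μ : ℝ} {n : ℕ} (hn : μ < n) {u : ℝ → ℝ}
    (hu : ContDiff ℝ (⊤ : ℕ∞) u) (huc : HasCompactSupport u) (x : ℝ) :
    leftFracDeriv μ n u x = 1 / Real.Gamma ((n : ℝ) - μ) *
      (dampedPower ((n : ℝ) - μ - 1) 0 ⋆[mul ℝ ℝ] iteratedDeriv n u) x := by
  have hint (x : ℝ) : ∫ t in Iic x, (x - t) ^ ((n : ℝ) - μ - 1) * u t =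
      (dampedPower ((n : ℝ) - μ - 1) 0 ⋆[mul ℝ ℝ] u) x := by
    rw [convolution_eq_swap, integral_Iic_eq_integral_Iio, ← integral_indicator measurableSet_Iio]
    congr 1 with t
    rcases lt_or_ge t x with h | h
    · simp [h, dampedPower_of_pos (sub_pos.2 h)]
    · simp [h, dampedPower_of_nonpos (sub_nonpos.2 h)]
  unfold leftFracDeriv
  simp_rw [hint]
  rw [iteratedDeriv_const_mul_field, iteratedDeriv_convolution
    (locallyIntegrable_dampedPower (by linarith) le_rfl) hu huc]

theorem rightFracDeriv_eq_leftFracDeriv_neg (μ : ℝ) (n : ℕ) (u : ℝ → ℝ) (x : ℝ) :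
    rightFracDeriv μ n u x = leftFracDeriv μ n (fun y => u (-y)) (-x) := by
  have hint (y : ℝ) : ∫ t in Ici y, (t - y) ^ ((n : ℝ) - μ - 1) * u t =
      ∫ t in Iic (-y), (-y - t) ^ ((n : ℝ) - μ - 1) * u (-t) := by
    have h := integral_comp_neg_Iic (-y) fun t => (t - y) ^ ((n : ℝ) - μ - 1) * u t
    rw [neg_neg] at h
    rw [integral_Ici_eq_integral_Ioi, ← h]
    congr 1 with t
    rw [show -y - t = -t - y by ring]
  unfold rightFracDeriv leftFracDeriv
  simp_rw [hint]
  rw [iteratedDeriv_comp_neg n (fun x => 1 / Real.Gamma ((n : ℝ) - μ) *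
    ∫ t in Iic x, (x - t) ^ ((n : ℝ) - μ - 1) * u (-t)), smul_eq_mul, ← mul_assoc, ← mul_pow]
  simp

/-- Equality of the left and right fractional derivative semi-norms on `C₀^∞(ℝ)`. -/
theorem leftFracDeriv_L2_eq_rightFracDeriv_L2 (μ : ℝ) (hμ : 0 < μ) (n : ℕ)
    (hn1 : (n : ℝ) - 1 ≤ μ) (hn2 : μ < n) :
    ∀ u : ℝ → ℝ, ContDiff ℝ (⊤ : ℕ∞) u → HasCompactSupport u →
      L2normR (leftFracDeriv μ n u) = L2normR (rightFracDeriv μ n u) := by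
  intro u hu huc
  have hn0 : n ≠ 0 := by
    rintro rfl
    simp only [Nat.cast_zero] at hn2
    linarith
  set p := (n : ℝ) - μ - 1
  have hp : -1 < p := by linarith
  have hp0 : p ≤ 0 := by linarith
  have hvc := hasCompactSupport_iteratedDeriv huc n
  have hv : Continuous (iteratedDeriv n u) :=
    hu.continuous_iteratedDeriv n (by exact_mod_cast le_top)
  have hu' : ContDiff ℝ (⊤ : ℕ∞) fun y => u (-y) := hu.comp contDiff_neg
  have huc' : HasCompactSupport fun y => u (-y) := huc.comp_homeomorph (Homeomorph.neg ℝ)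
  have hneg : iteratedDeriv n (fun y => u (-y)) =
      (-1 : ℝ) ^ n • fun y => iteratedDeriv n u (-y) := by
    ext y
    exact iteratedDeriv_comp_neg n u y
  unfold L2normR
  congr 1
  simp_rw [rightFracDeriv_eq_leftFracDeriv_neg]
  rw [integral_neg_eq_self (fun x => leftFracDeriv μ n (fun y => u (-y)) x ^ 2)]
  simp_rw [leftFracDeriv_eq_convolution hn2 hu huc, leftFracDeriv_eq_convolution hn2 hu' huc', hneg,
    convolution_smul, Pi.smul_apply, smul_eq_mul,
    mul_pow, ← pow_mul, mul_comm n 2, pow_mul, neg_one_sq, one_pow, one_mul, integral_const_mul]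
  rw [integral_convolution_dampedPower_sq_comp_neg hp hp0 hv hvc
    (integral_iteratedDeriv_eq_zero hu huc hn0)]
end

section
/- Let μ > 0, let n be the integer with n−1 ≤ μ < n, and set σ = n−μ. Define the left fractional derivative D^μ u(x) = (1/Γ(σ)) (d^n/dx^n) ∫_{−∞}^x (x−ξ)^{σ−1} u(ξ) dξ and the right fractional derivative D^{μ*} u(x) = ((−1)^n/Γ(σ)) (d^n/dx^n) ∫_x^{∞} (ξ−x)^{σ−1} u(ξ) dξ. Then for every real-valued smooth compactly supported function u on ℝ, ∫_ℝ (D^μ u)(x) (D^{μ*} u)(x) dx = cos(πμ) · ‖D^μ u‖²_{L²(ℝ)}. Consequently, for μ ≠ n−1/2 the semi-norms u ↦ |∫_ℝ (D^μ u)(D^{μ*} u) dx|^{1/2} and u ↦ ‖D^μ u‖_{L²(ℝ)} are equivalent on C₀^∞(ℝ). (Equivalence of the symmetric and left fractional derivative spaces.) -/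
open MeasureTheory

section

open Set Filter Topology ComplexConjugate FourierTransform ProbabilityTheory Convolution

theorem integrableOn_rpow_mul_exp_neg {σ r : ℝ} (hσ : 0 < σ) (hr : 0 < r) :
    IntegrableOn (fun s : ℝ => s ^ (σ - 1) * Real.exp (-(r * s))) (Ioi 0) := by
  simpa using integrableOn_rpow_mul_exp_neg_mul_rpow (s := σ - 1) (by linarith) one_pos hr

/-- The Laplace transform of `s ↦ s ^ (σ - 1)` on the right half plane. -/
theorem integral_rpow_mul_cexp_neg {σ : ℝ} (hσ : 0 < σ) {z : ℂ} (hz : 0 < z.re) :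
    ∫ s in Ioi (0 : ℝ), ((s ^ (σ - 1) : ℝ) : ℂ) * Complex.exp (-(z * s)) =
      Real.Gamma σ * z ^ (-σ : ℂ) := by
  set ν : Measure ℝ := (volume.restrict (Ioi 0)).withDensity
    fun s => ENNReal.ofReal (s ^ (σ - 1)) with hν
  have hmeas : Measurable fun s : ℝ => Real.toNNReal (s ^ (σ - 1)) := by fun_prop
  have hmgf (z : ℂ) : complexMGF id ν z =
      ∫ s in Ioi (0 : ℝ), ((s ^ (σ - 1) : ℝ) : ℂ) * Complex.exp (z * s) := by
    rw [complexMGF, hν, show (fun s : ℝ => ENNReal.ofReal (s ^ (σ - 1))) =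
      fun s => ((Real.toNNReal (s ^ (σ - 1)) : NNReal) : ENNReal) from rfl,
      integral_withDensity_eq_integral_smul hmeas]
    refine setIntegral_congr_fun measurableSet_Ioi fun s hs => ?_
    have : 0 ≤ s ^ (σ - 1) := Real.rpow_nonneg (le_of_lt hs) _
    simp [NNReal.smul_def, Real.coe_toNNReal _ this]
  have hsub : {z : ℂ | z.re < 0} ⊆ {z | z.re ∈ interior (integrableExpSet id ν)} := by
    intro z hz
    refine interior_maximal (s := integrableExpSet id ν) (t := Iio 0) ?_ isOpen_Iio hz
    intro r hr
    rw [integrableExpSet, mem_ofPred_eq, hν,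
      show (fun s : ℝ => ENNReal.ofReal (s ^ (σ - 1))) =
      fun s => ((Real.toNNReal (s ^ (σ - 1)) : NNReal) : ENNReal) from rfl,
      integrable_withDensity_iff_integrable_smul hmeas]
    refine (integrableOn_rpow_mul_exp_neg hσ (neg_pos.2 hr)).congr_fun (fun s hs => ?_)
      measurableSet_Ioi
    have : 0 ≤ s ^ (σ - 1) := Real.rpow_nonneg (le_of_lt hs) _
    simp [NNReal.smul_def, Real.coe_toNNReal _ this]
  have hopen : IsOpen {z : ℂ | z.re < 0} := isOpen_Iio.preimage Complex.continuous_re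
  have han : AnalyticOnNhd ℂ (fun z : ℂ => Real.Gamma σ * (-z) ^ (-σ : ℂ)) {z : ℂ | z.re < 0} := by
    refine DifferentiableOn.analyticOnNhd (fun z hz => ?_) hopen
    refine (DifferentiableAt.const_mul (DifferentiableAt.cpow_const differentiableAt_fun_id.neg ?_)
      _).differentiableWithinAt
    exact Or.inl (by simpa using hz)
  have heq : EqOn (complexMGF id ν) (fun z : ℂ => Real.Gamma σ * (-z) ^ (-σ : ℂ))
      {z : ℂ | z.re < 0} := by
    refine (analyticOnNhd_complexMGF.mono hsub).eqOn_of_preconnected_of_frequently_eq han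
      (convex_halfSpace_re_lt 0).isPreconnected (z₀ := -1) (by simp) ?_
    have hcont : Tendsto (fun x : ℝ => (x : ℂ)) (𝓝[≠] (-1)) (𝓝[≠] (-1)) := by
      refine tendsto_nhdsWithin_iff.2 ⟨?_, ?_⟩
      · exact ((Complex.continuous_ofReal.tendsto' (-1) (-1) (by simp))).mono_left
          nhdsWithin_le_nhds
      · filter_upwards [self_mem_nhdsWithin] with x hx h
        exact hx (by exact_mod_cast (show (x : ℂ) = ((-1 : ℝ) : ℂ) by simpa using h))
    refine hcont.frequently (Eventually.frequently ?_)
    filter_upwards [nhdsWithin_le_nhds (Iio_mem_nhds (show (-1 : ℝ) < 0 by norm_num))] with x hx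
    have hx' : 0 < -x := neg_pos.2 hx
    rw [complexMGF_ofReal]
    have h1 := Real.integral_rpow_mul_exp_neg_mul_Ioi hσ hx'
    have h2 := hmgf x
    rw [complexMGF_ofReal] at h2
    rw [h2, ← Complex.ofReal_neg, ← Complex.ofReal_neg, ← Complex.ofReal_cpow hx'.le]
    rw [one_div, Real.inv_rpow hx'.le, ← Real.rpow_neg hx'.le] at h1
    rw [← Complex.ofReal_mul, mul_comm (Real.Gamma σ), ← h1, ← integral_complex_ofReal]
    refine setIntegral_congr_fun measurableSet_Ioi fun s hs => ?_
    push_cast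
    ring_nf
  have := heq (show (-z).re < 0 by simpa using hz)
  rw [hmgf] at this
  simpa using this

/-- Parseval's identity for real functions. -/
theorem integral_mul_eq_integral_fourier_mul_conj {f g : ℝ → ℝ} (hf : Integrable f)
    (hg : Integrable g) (hgc : Continuous g)
    (hg' : Integrable (𝓕 fun x => (g x : ℂ))) :
    ((∫ x, f x * g x : ℝ) : ℂ) =
      ∫ ξ, 𝓕 (fun x => (f x : ℂ)) ξ * conj (𝓕 (fun x => (g x : ℂ)) ξ) := by
  have hinv := Continuous.fourierInv_fourier_eq (Complex.continuous_ofReal.comp hgc)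
    hg.ofReal hg'
  set G := 𝓕 fun x => (g x : ℂ) with hG
  have hG' : Integrable fun ξ => conj (G ξ) := by
    exact (Complex.conjCLE.toContinuousLinearMap).integrable_comp hg'
  have h := VectorFourier.integral_fourierIntegral_smul_eq_flip (L := innerₗ ℝ)
      Real.continuous_fourierChar continuous_inner (hf.ofReal (𝕜 := ℂ)) hG'
  have key (x : ℝ) : 𝓕 (fun ξ => conj (G ξ)) x = g x := by
    have h1 := congrFun hinv x
    have h2 : 𝓕 (fun ξ => conj (G ξ)) x = conj (𝓕⁻ G x) := by
      rw [Real.fourier_real_eq_integral_exp_smul, Real.fourierInv_eq_fourier_neg,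
        Real.fourier_real_eq_integral_exp_smul, ← integral_conj]
      congr 1
      ext v
      simp [← Complex.exp_conj, Complex.conj_ofNat]
    rw [h2, show 𝓕⁻ G x = (g x : ℂ) from h1, Complex.conj_ofReal]
  rw [← integral_complex_ofReal]
  simp only [smul_eq_mul] at h
  refine Eq.trans ?_ h.symm
  congr 1
  ext x
  have := key x
  push_cast
  rw [← this]
  rw [flip_innerₗ]
  rfl

theorem fourier_ofReal_comp_neg (f : ℝ → ℝ) (ξ : ℝ) :
    𝓕 (fun x => (f (-x) : ℂ)) ξ = conj (𝓕 (fun x => (f x : ℂ)) ξ) := by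
  rw [Real.fourier_real_eq_integral_exp_smul, Real.fourier_real_eq_integral_exp_smul,
    ← integral_conj, ← integral_neg_eq_self]
  congr 1
  ext v
  simp [← Complex.exp_conj, Complex.conj_ofNat]

/-- The kernel `s ↦ s ^ (σ - 1) * exp (-ε s)` on the positive half line. -/
noncomputable def expRpowKernel (σ ε : ℝ) : ℝ → ℝ :=
  (Ioi 0).indicator fun s => s ^ (σ - 1) * Real.exp (-(ε * s))

/-- Convolution with `expRpowKernel σ ε`; for `ε = 0` this is `Γ(σ)` times the left fractional
integral of order `σ`. -/
noncomputable def expRpowConv (σ ε : ℝ) (v : ℝ → ℝ) (x : ℝ) : ℝ :=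
  ∫ t, expRpowKernel σ ε t * v (x - t)

theorem measurable_expRpowKernel (σ ε : ℝ) : Measurable (expRpowKernel σ ε) :=
  Measurable.indicator (by fun_prop) measurableSet_Ioi

theorem expRpowKernel_nonneg (σ ε s : ℝ) : 0 ≤ expRpowKernel σ ε s :=
  indicator_nonneg (fun s (hs : 0 < s) => by positivity) s

theorem expRpowKernel_of_nonpos (σ ε : ℝ) {s : ℝ} (hs : s ≤ 0) : expRpowKernel σ ε s = 0 :=
  indicator_of_notMem (by simpa using hs) _

theorem expRpowKernel_of_pos (σ ε : ℝ) {s : ℝ} (hs : 0 < s) :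
    expRpowKernel σ ε s = s ^ (σ - 1) * Real.exp (-(ε * s)) :=
  indicator_of_mem (by simpa using hs) _

theorem expRpowKernel_le (σ : ℝ) {ε : ℝ} (hε : 0 ≤ ε) (s : ℝ) :
    expRpowKernel σ ε s ≤ expRpowKernel σ 0 s := by
  rcases le_or_gt s 0 with hs | hs
  · simp [expRpowKernel_of_nonpos _ _ hs]
  · rw [expRpowKernel_of_pos _ _ hs, expRpowKernel_of_pos _ _ hs]
    gcongr

theorem integrable_expRpowKernel {σ ε : ℝ} (hσ : 0 < σ) (hε : 0 < ε) :
    Integrable (expRpowKernel σ ε) :=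
  (integrable_indicator_iff measurableSet_Ioi).2 (integrableOn_rpow_mul_exp_neg hσ hε)

theorem locallyIntegrable_expRpowKernel_zero {σ : ℝ} (hσ : 0 < σ) :
    LocallyIntegrable (expRpowKernel σ 0) := by
  have hb (b : ℝ) : IntegrableOn (expRpowKernel σ 0) (Ioc 0 b) := by
    have h : IntegrableOn (fun s : ℝ => s ^ (σ - 1)) (Ioc 0 b) :=
      (intervalIntegral.intervalIntegrable_rpow' (by linarith) (a := 0) (b := b)).1
    exact h.congr_fun (fun s hs => by simp [expRpowKernel_of_pos _ _ hs.1]) measurableSet_Ioc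
  refine locallyIntegrable_iff.2 fun k hk => ?_
  obtain ⟨b, hkb⟩ := hk.bddAbove
  have : IntegrableOn (expRpowKernel σ 0) (Iic 0) :=
    integrableOn_zero.congr_fun (fun s hs => (expRpowKernel_of_nonpos _ _ hs).symm)
      measurableSet_Iic
  refine (this.union (hb b)).mono_set fun s hs => ?_
  rcases le_or_gt s 0 with h | h
  · exact Or.inl h
  · exact Or.inr ⟨h, hkb hs⟩

theorem integrable_expRpowKernel_zero_mul {σ : ℝ} (hσ : 0 < σ) {v : ℝ → ℝ} (hv : Continuous v)
    (hcv : HasCompactSupport v) (x : ℝ) :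
    Integrable fun t => expRpowKernel σ 0 t * v (x - t) :=
  hcv.convolutionExists_right (ContinuousLinearMap.mul ℝ ℝ)
    (locallyIntegrable_expRpowKernel_zero hσ) hv x

theorem tendsto_expRpowConv {σ : ℝ} (hσ : 0 < σ) {v : ℝ → ℝ} (hv : Continuous v)
    (hcv : HasCompactSupport v) (x : ℝ) :
    Tendsto (fun ε => expRpowConv σ ε v x) (𝓝[>] 0) (𝓝 (expRpowConv σ 0 v x)) := by
  refine tendsto_integral_filter_of_dominated_convergence
    (fun t => ‖expRpowKernel σ 0 t * v (x - t)‖) ?_ ?_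
    (integrable_expRpowKernel_zero_mul hσ hv hcv x).norm ?_
  · exact Eventually.of_forall fun ε =>
      ((measurable_expRpowKernel σ ε).mul (by fun_prop)).aestronglyMeasurable
  · filter_upwards [self_mem_nhdsWithin] with ε hε
    refine ae_of_all _ fun t => ?_
    rw [norm_mul, norm_mul, Real.norm_of_nonneg (expRpowKernel_nonneg _ _ _),
      Real.norm_of_nonneg (expRpowKernel_nonneg _ _ _)]
    gcongr
    exact expRpowKernel_le σ (le_of_lt hε) t
  · refine ae_of_all _ fun t => Tendsto.mul_const _ ?_
    rcases le_or_gt t 0 with ht | ht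
    · simp [expRpowKernel_of_nonpos _ _ ht]
    · simp only [expRpowKernel_of_pos _ _ ht]
      have : Continuous fun ε : ℝ => t ^ (σ - 1) * Real.exp (-(ε * t)) := by fun_prop
      exact (this.tendsto 0).mono_left nhdsWithin_le_nhds

theorem fourier_expRpowKernel {σ ε : ℝ} (hσ : 0 < σ) (hε : 0 < ε) (ξ : ℝ) :
    𝓕 (fun x => (expRpowKernel σ ε x : ℂ)) ξ =
      Real.Gamma σ * (ε + 2 * Real.pi * ξ * Complex.I : ℂ) ^ (-σ : ℂ) := by
  rw [← integral_rpow_mul_cexp_neg hσ (by simpa using hε), Real.fourier_real_eq_integral_exp_smul,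
    ← integral_indicator measurableSet_Ioi]
  congr 1
  ext s
  rcases le_or_gt s 0 with hs | hs
  · simp [expRpowKernel_of_nonpos _ _ hs, hs]
  · rw [indicator_of_mem (by simpa using hs), expRpowKernel_of_pos _ _ hs]
    push_cast
    rw [smul_eq_mul, mul_comm, mul_assoc, ← Complex.exp_add]
    ring_nf

theorem continuous_expRpowConv {σ ε : ℝ} (hσ : 0 < σ) (hε : 0 < ε) {v : ℝ → ℝ}
    (hv : Continuous v) (hcv : HasCompactSupport v) : Continuous (expRpowConv σ ε v) :=
  hcv.continuous_convolution_right (ContinuousLinearMap.mul ℝ ℝ)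
    (integrable_expRpowKernel hσ hε).locallyIntegrable hv

theorem integrable_expRpowConv {σ ε : ℝ} (hσ : 0 < σ) (hε : 0 < ε) {v : ℝ → ℝ}
    (hv : Continuous v) (hcv : HasCompactSupport v) : Integrable (expRpowConv σ ε v) :=
  (integrable_expRpowKernel hσ hε).integrable_convolution (ContinuousLinearMap.mul ℝ ℝ)
    (hv.integrable_of_hasCompactSupport hcv)

theorem fourier_expRpowConv {σ ε : ℝ} (hσ : 0 < σ) (hε : 0 < ε) {v : ℝ → ℝ}
    (hv : Continuous v) (hcv : HasCompactSupport v) (ξ : ℝ) :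
    𝓕 (fun x => (expRpowConv σ ε v x : ℂ)) ξ =
      Real.Gamma σ * (ε + 2 * Real.pi * ξ * Complex.I : ℂ) ^ (-σ : ℂ) *
        𝓕 (fun x => (v x : ℂ)) ξ := by
  rw [← fourier_expRpowKernel hσ hε]
  refine Eq.trans ?_ (Real.fourier_mul_convolution_eq (integrable_expRpowKernel hσ hε).ofReal
    (hv.integrable_of_hasCompactSupport hcv).ofReal ξ)
  refine congrArg (fun h : ℝ → ℂ => 𝓕 h ξ) (funext fun x => ?_)
  rw [expRpowConv, ← integral_complex_ofReal]
  simp [convolution]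

/-- Comparison of `cos (π σ) ‖K ⋆ v‖²` with the pairing of `K ⋆ v` and its reflected counterpart,
on the Fourier side. -/
theorem integral_expRpowConv_mul_sub {σ ε : ℝ} (hσ : 0 < σ) (hε : 0 < ε) {v : ℝ → ℝ}
    (hv : Continuous v) (hcv : HasCompactSupport v)
    (hV : Integrable (𝓕 fun x => (v x : ℂ))) (c : ℝ) :
    (∫ x, expRpowConv σ ε v x * expRpowConv σ ε (fun y => v (-y)) (-x)) -
        c * ∫ x, (expRpowConv σ ε v x) ^ 2 =
      Real.Gamma σ ^ 2 * ∫ ξ : ℝ,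
        ((((ε + 2 * Real.pi * ξ * Complex.I : ℂ) ^ (-σ : ℂ)) ^ 2).re -
          c * ‖(ε + 2 * Real.pi * ξ * Complex.I : ℂ) ^ (-σ : ℂ)‖ ^ 2) *
            ‖𝓕 (fun x => (v x : ℂ)) ξ‖ ^ 2 := by
  have hcv' : HasCompactSupport fun y => v (-y) := hcv.comp_homeomorph (Homeomorph.neg ℝ)
  have hv' : Continuous fun y => v (-y) := by fun_prop
  have hf := integrable_expRpowConv hσ hε hv hcv
  have hg := (integrable_expRpowConv hσ hε hv' hcv').comp_neg
  have hfc := continuous_expRpowConv hσ hε hv hcv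
  have hgc : Continuous fun x => expRpowConv σ ε (fun y => v (-y)) (-x) :=
    (continuous_expRpowConv hσ hε hv' hcv').comp continuous_neg
  set f := expRpowConv σ ε v with hfdef
  set g := fun x => expRpowConv σ ε (fun y => v (-y)) (-x) with hgdef
  set V := 𝓕 fun x => (v x : ℂ) with hVdef
  set z : ℝ → ℂ := fun ξ => (ε + 2 * Real.pi * ξ * Complex.I : ℂ) ^ (-σ : ℂ) with hz
  have hzc : Continuous z := by
    refine continuous_iff_continuousAt.2 fun ξ => ?_
    exact ContinuousAt.cpow (by fun_prop) continuousAt_const (Or.inl (by simpa using hε))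
  have hVc : Continuous V := VectorFourier.fourierIntegral_continuous
    Real.continuous_fourierChar continuous_inner (hv.integrable_of_hasCompactSupport hcv).ofReal
  have hVb (ξ : ℝ) : ‖V ξ‖ ≤ ∫ x, ‖(v x : ℂ)‖ :=
    VectorFourier.norm_fourierIntegral_le_integral_norm _ _ _ _ _
  have hF (ξ : ℝ) : 𝓕 (fun x => (f x : ℂ)) ξ = Real.Gamma σ * z ξ * V ξ :=
    fourier_expRpowConv hσ hε hv hcv ξ
  have hG (ξ : ℝ) : 𝓕 (fun x => (g x : ℂ)) ξ = conj (Real.Gamma σ * z ξ) * V ξ := by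
    rw [hgdef, fourier_ofReal_comp_neg, fourier_expRpowConv hσ hε hv' hcv',
      fourier_ofReal_comp_neg, map_mul, Complex.conj_conj]
  have hzb : ∃ C, ∀ ξ, ‖z ξ‖ ≤ C := by
    refine ⟨ε ^ (-σ), fun ξ => ?_⟩
    rw [hz, ← Complex.ofReal_neg, Complex.norm_cpow_real]
    refine Real.rpow_le_rpow_of_nonpos hε ?_ (by linarith)
    refine le_trans ?_ (Complex.re_le_norm _)
    simp
  obtain ⟨C, hC⟩ := hzb
  have hFi : Integrable (𝓕 fun x => (f x : ℂ)) := by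
    rw [funext hF]
    simp only [mul_assoc]
    exact (hV.bdd_mul hzc.aestronglyMeasurable (ae_of_all _ hC)).const_mul _
  have hGi : Integrable (𝓕 fun x => (g x : ℂ)) := by
    rw [funext hG]
    refine hV.bdd_mul (c := ‖(Real.Gamma σ : ℂ)‖ * C)
      (by fun_prop) (ae_of_all _ fun ξ => ?_)
    rw [RCLike.norm_conj, norm_mul]
    gcongr
    exact hC ξ
  have hQ := integral_mul_eq_integral_fourier_mul_conj hf hg hgc hGi
  have hP := integral_mul_eq_integral_fourier_mul_conj hf hf hfc hFi
  have hV2 : Integrable fun ξ => (‖V ξ‖ ^ 2 : ℂ) := by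
    have := (hV.norm.bdd_mul hVc.norm.aestronglyMeasurable
      (ae_of_all _ fun ξ => by simpa using hVb ξ)).ofReal (𝕜 := ℂ)
    simpa [sq] using this
  have hzV (y : ℝ → ℂ) (hy : Continuous y) (hyb : ∀ ξ, ‖y ξ‖ ≤ C) :
      Integrable fun ξ => y ξ * z ξ * (‖V ξ‖ ^ 2 : ℂ) := by
    refine hV2.bdd_mul (c := C * C) (by fun_prop) (ae_of_all _ fun ξ => ?_)
    rw [norm_mul]
    exact mul_le_mul (hyb ξ) (hC ξ) (norm_nonneg _) ((norm_nonneg _).trans (hyb ξ))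
  have h1 := hzV z hzc hC
  have h2 := hzV (fun ξ => conj (z ξ)) (by fun_prop) (fun ξ => by simpa using hC ξ)
  have hQ' : ∫ x, f x * g x = Real.Gamma σ ^ 2 * ∫ ξ, (z ξ * z ξ * (‖V ξ‖ ^ 2 : ℂ)).re := by
    have h3 := integral_re h1
    simp only [RCLike.re_eq_complex_re] at h3
    rw [h3, ← Complex.ofReal_re (∫ x, f x * g x), hQ, ← Complex.re_ofReal_mul,
      ← integral_const_mul]
    congr 2
    ext ξ
    rw [hF, hG, map_mul, Complex.conj_conj, ← Complex.mul_conj']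
    push_cast
    ring
  have hP' : ∫ x, f x ^ 2 =
      Real.Gamma σ ^ 2 * ∫ ξ, (conj (z ξ) * z ξ * (‖V ξ‖ ^ 2 : ℂ)).re := by
    have h3 := integral_re h2
    simp only [RCLike.re_eq_complex_re] at h3
    simp only [sq (f _)]
    rw [h3, ← Complex.ofReal_re (∫ x, f x * f x), hP, ← Complex.re_ofReal_mul,
      ← integral_const_mul]
    congr 2
    ext ξ
    rw [hF, map_mul, map_mul, Complex.conj_ofReal, ← Complex.mul_conj']
    push_cast
    ring
  have h1' : Integrable fun ξ => (z ξ * z ξ * (‖V ξ‖ ^ 2 : ℂ)).re := h1.re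
  have h2' : Integrable fun ξ => (conj (z ξ) * z ξ * (‖V ξ‖ ^ 2 : ℂ)).re := h2.re
  rw [hQ', hP', mul_left_comm, ← mul_sub, ← integral_const_mul, ← integral_sub h1'
    (h2'.const_mul c)]
  congr 2
  ext ξ
  change _ = ((z ξ ^ 2).re - c * ‖z ξ‖ ^ 2) * ‖V ξ‖ ^ 2
  rw [Complex.conj_mul']
  norm_cast
  simp only [Complex.re_mul_ofReal]
  ring_nf

theorem re_sq_cpow_imaginary (σ : ℝ) {r : ℝ} (hr : r ≠ 0) :
    (((r * Complex.I : ℂ) ^ (-σ : ℂ)) ^ 2).re =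
      Real.cos (Real.pi * σ) * ‖(r * Complex.I : ℂ) ^ (-σ : ℂ)‖ ^ 2 := by
  have hne : (r * Complex.I : ℂ) ≠ 0 := by simpa using hr
  have harg : Real.cos (2 * (σ * (r * Complex.I : ℂ).arg)) = Real.cos (Real.pi * σ) := by
    rcases lt_or_gt_of_ne hr with h | h
    · rw [Complex.arg_eq_neg_pi_div_two_iff.2 ⟨by simp, by simpa using h⟩, ← Real.cos_neg]
      ring_nf
    · rw [Complex.arg_real_mul _ h, Complex.arg_I]
      ring_nf
  rw [Complex.cpow_def_of_ne_zero hne, ← Complex.exp_nat_mul, Complex.norm_exp, ← Real.exp_nat_mul,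
    Complex.exp_re, mul_comm, ← harg, ← Real.cos_neg]
  simp [Complex.log_im]
  ring_nf

theorem tendsto_re_sq_cpow_sub (σ : ℝ) {ξ : ℝ} (hξ : ξ ≠ 0) :
    Tendsto (fun ε : ℝ => (((ε + 2 * Real.pi * ξ * Complex.I : ℂ) ^ (-σ : ℂ)) ^ 2).re -
      Real.cos (Real.pi * σ) * ‖(ε + 2 * Real.pi * ξ * Complex.I : ℂ) ^ (-σ : ℂ)‖ ^ 2)
      (𝓝[>] 0) (𝓝 0) := by
  have hr : 2 * Real.pi * ξ ≠ 0 := by positivity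
  have hc : ContinuousAt
      (fun ε : ℝ => (ε + 2 * Real.pi * ξ * Complex.I : ℂ) ^ (-σ : ℂ)) 0 :=
    ContinuousAt.cpow (by fun_prop) continuousAt_const (Or.inr (by simpa using hξ))
  have h : ContinuousAt (fun ε : ℝ =>
      (((ε + 2 * Real.pi * ξ * Complex.I : ℂ) ^ (-σ : ℂ)) ^ 2).re -
      Real.cos (Real.pi * σ) * ‖(ε + 2 * Real.pi * ξ * Complex.I : ℂ) ^ (-σ : ℂ)‖ ^ 2) 0 :=
    (Complex.continuous_re.continuousAt.comp (hc.pow 2)).sub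
      (continuousAt_const.mul (hc.norm.pow 2))
  have h0 := re_sq_cpow_imaginary σ hr
  push_cast at h0
  have := h.tendsto
  simp only [Complex.ofReal_zero, zero_add, h0, sub_self] at this
  exact this.mono_left nhdsWithin_le_nhds

theorem norm_cpow_sq_mul_sq_le {σ : ℝ} (hσ : 0 < σ) (hσ1 : σ ≤ 1) {z : ℂ} (hz : 0 < z.im ^ 2) :
    ‖z ^ (-σ : ℂ)‖ ^ 2 * z.im ^ 2 ≤ 1 + z.im ^ 2 := by
  have him : 0 < |z.im| := abs_pos.2 fun h => by simp [h] at hz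
  have h1 : ‖z ^ (-σ : ℂ)‖ ≤ |z.im| ^ (-σ) := by
    rw [← Complex.ofReal_neg, Complex.norm_cpow_real]
    exact Real.rpow_le_rpow_of_nonpos him (Complex.abs_im_le_norm z) (by linarith)
  have h2 : |z.im| ^ (-σ) * |z.im| ≤ max 1 |z.im| := by
    rw [← Real.rpow_add_one him.ne']
    rcases le_total |z.im| 1 with h | h
    · exact (Real.rpow_le_one him.le h (by linarith)).trans (le_max_left _ _)
    · refine le_trans ?_ (le_max_right _ _)
      simpa using Real.rpow_le_rpow_of_exponent_le h (show -σ + 1 ≤ 1 by linarith)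
  calc ‖z ^ (-σ : ℂ)‖ ^ 2 * z.im ^ 2 = (‖z ^ (-σ : ℂ)‖ * |z.im|) ^ 2 := by
        rw [mul_pow, sq_abs]
    _ ≤ (max 1 |z.im|) ^ 2 := by
        gcongr
        exact (mul_le_mul_of_nonneg_right h1 him.le).trans h2
    _ ≤ 1 + z.im ^ 2 := by
        rcases max_cases 1 |z.im| with h | h
        · rw [h.1]; nlinarith
        · rw [h.1, sq_abs]; linarith

theorem tendsto_integral_re_sq_cpow_sub {σ : ℝ} (hσ : 0 < σ) (hσ1 : σ ≤ 1) {w : ℝ → ℝ}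
    (hw : ContDiff ℝ (⊤ : ℕ∞) w) (hcw : HasCompactSupport w) :
    Integrable (𝓕 fun x => ((deriv w x : ℝ) : ℂ)) ∧
    Tendsto (fun ε : ℝ => ∫ ξ : ℝ,
        ((((ε + 2 * Real.pi * ξ * Complex.I : ℂ) ^ (-σ : ℂ)) ^ 2).re -
          Real.cos (Real.pi * σ) * ‖(ε + 2 * Real.pi * ξ * Complex.I : ℂ) ^ (-σ : ℂ)‖ ^ 2) *
            ‖𝓕 (fun x => ((deriv w x : ℝ) : ℂ)) ξ‖ ^ 2) (𝓝[>] 0) (𝓝 0) := by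
  have hcw' : HasCompactSupport fun x => (w x : ℂ) := hcw.comp_left (g := Complex.ofReal) (by simp)
  let W : SchwartzMap ℝ ℂ := hcw'.toSchwartzMap (Complex.ofRealCLM.contDiff.comp hw)
  have hWw : (W : ℝ → ℂ) = fun x => (w x : ℂ) := rfl
  let W' : SchwartzMap ℝ ℂ := SchwartzMap.derivCLM ℂ ℂ W
  have hd : (fun x => ((deriv w x : ℝ) : ℂ)) = deriv fun x => (w x : ℂ) := by
    ext x
    exact (((hw.differentiable (by simp)) x).hasDerivAt.ofReal_comp.deriv).symm
  have hW'w : (W' : ℝ → ℂ) = deriv fun x => (w x : ℂ) := rfl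
  have hmem (S : SchwartzMap ℝ ℂ) : Integrable fun ξ => ‖S ξ‖ ^ 2 := by
    exact (S.memLp 2).integrable_norm_pow (by norm_num)
  have hV : 𝓕 (fun x => ((deriv w x : ℝ) : ℂ)) = 𝓕 W' := by
    rw [SchwartzMap.fourier_coe, hd, hW'w]
  have hVW (ξ : ℝ) : ‖(𝓕 W') ξ‖ ^ 2 = (2 * Real.pi * ξ) ^ 2 * ‖(𝓕 W) ξ‖ ^ 2 := by
    rw [SchwartzMap.fourier_coe, SchwartzMap.fourier_coe, hW'w, ← hWw,
      Real.fourier_deriv W.integrable W.differentiable W'.integrable]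
    rw [norm_smul, mul_pow]
    simp [mul_pow]
  rw [hV]
  refine ⟨(𝓕 W').integrable, ?_⟩
  rw [← integral_zero ℝ ℝ]
  refine tendsto_integral_filter_of_dominated_convergence
    (fun ξ => 2 * (‖(𝓕 W) ξ‖ ^ 2 + ‖(𝓕 W') ξ‖ ^ 2)) ?_ ?_
    (((hmem (𝓕 W)).add (hmem (𝓕 W'))).const_mul 2) ?_
  · refine Eventually.of_forall fun ε => Measurable.aestronglyMeasurable ?_
    have := (𝓕 W').continuous.measurable
    fun_prop
  · refine Eventually.of_forall fun ε => ?_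
    have h0 : ∀ᵐ ξ : ℝ, ξ ≠ 0 := by simp [ae_iff, measure_singleton]
    filter_upwards [h0] with ξ hξ
    set z : ℂ := ε + 2 * Real.pi * ξ * Complex.I with hz
    have him : z.im = 2 * Real.pi * ξ := by simp [hz]
    have hb := norm_cpow_sq_mul_sq_le (z := z) hσ hσ1 (by rw [him]; positivity)
    rw [him] at hb
    have h1 : ‖z ^ (-σ : ℂ)‖ ^ 2 * ‖(𝓕 W') ξ‖ ^ 2 ≤ ‖(𝓕 W) ξ‖ ^ 2 + ‖(𝓕 W') ξ‖ ^ 2 := by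
      rw [hVW]
      nlinarith [sq_nonneg ‖(𝓕 W) ξ‖]
    have h2 : |((z ^ (-σ : ℂ)) ^ 2).re| ≤ ‖z ^ (-σ : ℂ)‖ ^ 2 := by
      rw [← norm_pow]
      exact Complex.abs_re_le_norm _
    have h3 : |Real.cos (Real.pi * σ) * ‖z ^ (-σ : ℂ)‖ ^ 2| ≤ ‖z ^ (-σ : ℂ)‖ ^ 2 := by
      rw [abs_mul, abs_of_nonneg (sq_nonneg ‖z ^ (-σ : ℂ)‖)]
      exact mul_le_of_le_one_left (sq_nonneg _) (Real.abs_cos_le_one _)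
    rw [norm_mul, Real.norm_eq_abs, norm_pow, norm_norm]
    calc _ ≤ (2 * ‖z ^ (-σ : ℂ)‖ ^ 2) * ‖(𝓕 W') ξ‖ ^ 2 := by
          gcongr
          exact (abs_sub _ _).trans (by linarith)
      _ ≤ _ := by linarith
  · have h0 : ∀ᵐ ξ : ℝ, ξ ≠ 0 := by simp [ae_iff, measure_singleton]
    filter_upwards [h0] with ξ hξ
    simpa using (tendsto_re_sq_cpow_sub σ hξ).mul_const (‖(𝓕 W') ξ‖ ^ 2)

theorem abs_deriv_rpow_mul_exp_neg_le {σ ε s : ℝ} (hσ : 0 < σ) (hσ1 : σ ≤ 1) (hε : 0 ≤ ε)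
    (hs : 1 ≤ s) :
    |(σ - 1) * s ^ (σ - 1 - 1) * Real.exp (-(ε * s)) +
      s ^ (σ - 1) * (-ε * Real.exp (-(ε * s)))| ≤ 2 * s⁻¹ := by
  have hs0 : 0 < s := by linarith
  have h1 : s ^ (σ - 1) = s ^ (σ - 1 - 1) * s := by
    rw [← Real.rpow_add_one hs0.ne']
    ring_nf
  have h2 : s ^ (σ - 1 - 1) ≤ s⁻¹ := by
    rw [← Real.rpow_neg_one]
    exact Real.rpow_le_rpow_of_exponent_le hs (by linarith)
  have h3 : Real.exp (-(ε * s)) ≤ 1 := Real.exp_le_one_iff.2 (by simpa using by positivity)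
  have h4 : ε * s * Real.exp (-(ε * s)) ≤ 1 := by
    rw [Real.exp_neg, ← div_eq_mul_inv, div_le_one (Real.exp_pos _)]
    linarith [Real.add_one_le_exp (ε * s)]
  have h5 : 0 ≤ ε * s * Real.exp (-(ε * s)) := by positivity
  have h6 : (1 - σ) * Real.exp (-(ε * s)) ≤ 1 :=
    mul_le_one₀ (by linarith) (Real.exp_pos _).le h3
  have h7 : 0 ≤ (1 - σ) * Real.exp (-(ε * s)) :=
    mul_nonneg (by linarith) (Real.exp_pos _).le
  have h8 : 0 < s ^ (σ - 1 - 1) := by positivity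
  calc _ = |-(s ^ (σ - 1 - 1) * ((1 - σ) * Real.exp (-(ε * s)) +
        ε * s * Real.exp (-(ε * s))))| := by
        rw [h1]
        ring_nf
    _ = s ^ (σ - 1 - 1) * ((1 - σ) * Real.exp (-(ε * s)) + ε * s * Real.exp (-(ε * s))) := by
        rw [abs_neg, abs_of_nonneg (by positivity)]
    _ ≤ s⁻¹ * 2 := by
        gcongr
        linarith
    _ = 2 * s⁻¹ := mul_comm _ _

theorem abs_expRpowConv_deriv_le {σ ε R A x : ℝ} (hσ : 0 < σ) (hσ1 : σ ≤ 1) (hε : 0 ≤ ε)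
    {w : ℝ → ℝ} (hw : ContDiff ℝ 1 w) (hR : tsupport w ⊆ Ioo (-R) R) (hA : ∀ y, |w y| ≤ A)
    (hR0 : 0 ≤ R) (hx : R + 1 ≤ x) :
    |expRpowConv σ ε (deriv w) x| ≤ 4 * R * A * (x - R)⁻¹ := by
  have hsupp : Function.support (fun t => expRpowKernel σ ε t * deriv w (x - t)) ⊆
      Ioc (x - R) (x + R) := by
    intro t ht
    have := hR (support_deriv_subset (right_ne_zero_of_mul ht))
    exact ⟨by linarith [this.2], by linarith [this.1]⟩
  have hI : ∀ t ∈ uIcc (x - R) (x + R), 1 ≤ t := by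
    intro t ht
    rw [uIcc_of_le (by linarith)] at ht
    linarith [ht.1]
  have hwR : w R = 0 := image_eq_zero_of_notMem_tsupport fun h => lt_irrefl _ (hR h).2
  have hwR' : w (-R) = 0 := image_eq_zero_of_notMem_tsupport fun h => lt_irrefl _ (hR h).1
  have hu : ∀ t ∈ uIcc (x - R) (x + R), HasDerivAt
      (fun s : ℝ => s ^ (σ - 1) * Real.exp (-(ε * s)))
      ((σ - 1) * t ^ (σ - 1 - 1) * Real.exp (-(ε * t)) +
        t ^ (σ - 1) * (-ε * Real.exp (-(ε * t)))) t := by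
    intro t ht
    have h0 : t ≠ 0 := by linarith [hI t ht]
    refine (Real.hasDerivAt_rpow_const (Or.inl h0)).mul ?_
    exact ((hasDerivAt_id' t).const_mul ε).neg.exp.congr_deriv (by rw [mul_one]; exact mul_comm _ _)
  have hv : ∀ t ∈ uIcc (x - R) (x + R), HasDerivAt (fun s => -w (x - s)) (deriv w (x - t)) t := by
    intro t _
    exact ((hw.differentiable one_ne_zero (x - t)).hasDerivAt.comp_const_sub x t).neg.congr_deriv
      (neg_neg _)
  have hu' : IntervalIntegrable (fun t : ℝ => (σ - 1) * t ^ (σ - 1 - 1) * Real.exp (-(ε * t)) +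
      t ^ (σ - 1) * (-ε * Real.exp (-(ε * t)))) volume (x - R) (x + R) := by
    refine ContinuousOn.intervalIntegrable fun t ht => ContinuousAt.continuousWithinAt ?_
    have h0 : t ≠ 0 := by linarith [hI t ht]
    have (p : ℝ) : ContinuousAt (fun t : ℝ => t ^ p) t :=
      Real.continuousAt_rpow_const _ _ (Or.inl h0)
    have he : ContinuousAt (fun t => Real.exp (-(ε * t))) t := by fun_prop
    exact ((continuousAt_const.mul (this _)).mul he).add ((this _).mul (continuousAt_const.mul he))
  have hv' : IntervalIntegrable (fun t => deriv w (x - t)) volume (x - R) (x + R) :=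
    ((hw.continuous_deriv le_rfl).comp (by fun_prop)).intervalIntegrable _ _
  have hparts := intervalIntegral.integral_mul_deriv_eq_deriv_mul hu hv hu' hv'
  have heq : expRpowConv σ ε (deriv w) x =
      ∫ t in (x - R)..(x + R), t ^ (σ - 1) * Real.exp (-(ε * t)) * deriv w (x - t) := by
    rw [expRpowConv, ← intervalIntegral.integral_eq_integral_of_support_subset hsupp]
    refine intervalIntegral.integral_congr fun t ht => ?_
    have : 0 < t := by linarith [hI t ht]
    simp only [expRpowKernel_of_pos _ _ this]
  have e1 : x - (x + R) = -R := by ring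
  have e2 : x - (x - R) = R := by ring
  rw [heq, hparts, e1, e2, hwR, hwR']
  simp only [neg_zero, mul_zero, sub_zero, zero_sub, abs_neg]
  rw [← Real.norm_eq_abs]
  refine (intervalIntegral.norm_integral_le_of_norm_le_const (C := 2 * (x - R)⁻¹ * A)
    fun t ht => ?_).trans_eq ?_
  · have ht' := hI t (uIoc_subset_uIcc ht)
    rw [uIoc_of_le (by linarith)] at ht
    rw [norm_mul, norm_neg, Real.norm_eq_abs, Real.norm_eq_abs]
    have hxR : 0 < x - R := by linarith
    refine mul_le_mul ((abs_deriv_rpow_mul_exp_neg_le hσ hσ1 hε ht').trans ?_) (hA _)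
      (abs_nonneg _) (by positivity)
    gcongr
    exact ht.1.le
  · rw [show x + R - (x - R) = 2 * R by ring, abs_of_nonneg (by positivity)]
    ring

/-- The fractional integral of a derivative decays at infinity, uniformly in `ε`. -/
theorem exists_sq_expRpowConv_deriv_le {σ : ℝ} (hσ : 0 < σ) (hσ1 : σ ≤ 1) {w : ℝ → ℝ}
    (hw : ContDiff ℝ 1 w) (hcw : HasCompactSupport w) :
    ∃ C, ∀ ε, 0 ≤ ε → ∀ x, expRpowConv σ ε (deriv w) x ^ 2 ≤ C * (1 + x ^ 2)⁻¹ := by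
  obtain ⟨R, hR0, hR⟩ : ∃ R, 0 ≤ R ∧ tsupport w ⊆ Ioo (-R) R := by
    obtain ⟨R, hR0, hR⟩ := hcw.isBounded.subset_ball_lt 0 0
    exact ⟨R, hR0.le, by simpa [Real.ball_eq_Ioo] using hR⟩
  obtain ⟨A, hA⟩ := hcw.exists_bound_of_continuous hw.continuous
  obtain ⟨B, hB⟩ := hcw.deriv.exists_bound_of_continuous (hw.continuous_deriv le_rfl)
  have hB0 : 0 ≤ B := (norm_nonneg _).trans (hB 0)
  have hout {y : ℝ} (hy : y ≤ -R) : deriv w y = 0 := by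
    by_contra h
    linarith [(hR (support_deriv_subset h)).1]
  set D := ∫ t in Ioc 0 (2 * R + 1), expRpowKernel σ 0 t * B with hD
  set E := 4 * R * A with hE
  have hnear {ε : ℝ} (hε : 0 ≤ ε) {x : ℝ} (hx : x ≤ R + 1) :
      |expRpowConv σ ε (deriv w) x| ≤ D := by
    rw [hD, ← integral_indicator measurableSet_Ioc, expRpowConv, ← Real.norm_eq_abs]
    refine norm_integral_le_of_norm_le ((integrable_indicator_iff measurableSet_Ioc).2
      (IntegrableOn.mono_set (t := Icc 0 (2 * R + 1)) ?_ Ioc_subset_Icc_self))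
      (ae_of_all _ fun t => ?_)
    · exact ((locallyIntegrable_expRpowKernel_zero hσ).integrableOn_isCompact
        isCompact_Icc).mul_const B
    · by_cases ht : t ∈ Ioc 0 (2 * R + 1)
      · rw [indicator_of_mem ht, norm_mul, Real.norm_of_nonneg (expRpowKernel_nonneg _ _ _)]
        exact mul_le_mul (expRpowKernel_le σ hε t) (hB _) (norm_nonneg _)
          (expRpowKernel_nonneg _ _ _)
      · rw [indicator_of_notMem ht]
        rcases le_or_gt t 0 with h | h
        · simp [expRpowKernel_of_nonpos _ _ h]
        · have : 2 * R + 1 < t := not_le.1 fun h' => ht ⟨h, h'⟩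
          simp [hout (show x - t ≤ -R by linarith)]
  have hleft (ε : ℝ) {x : ℝ} (hx : x ≤ -(R + 1)) : expRpowConv σ ε (deriv w) x = 0 := by
    refine integral_eq_zero_of_ae (ae_of_all _ fun t => ?_)
    rcases le_or_gt t 0 with h | h
    · simp [expRpowKernel_of_nonpos _ _ h]
    · simp [hout (show x - t ≤ -R by linarith)]
  refine ⟨(1 + (R + 1) ^ 2) * (D ^ 2 + E ^ 2), fun ε hε x => ?_⟩
  rw [← div_eq_mul_inv, le_div_iff₀ (by positivity)]
  rcases le_or_gt x (-(R + 1)) with h | h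
  · rw [hleft ε h, zero_pow two_ne_zero, zero_mul]
    positivity
  rcases le_or_gt x (R + 1) with h' | h'
  · have h1 : expRpowConv σ ε (deriv w) x ^ 2 ≤ D ^ 2 :=
      sq_le_sq.2 ((hnear hε h').trans (le_abs_self _))
    have h2 : x ^ 2 ≤ (R + 1) ^ 2 := sq_le_sq' h.le h'
    calc _ ≤ (D ^ 2 + E ^ 2) * (1 + (R + 1) ^ 2) := by
          gcongr
          linarith [sq_nonneg E]
      _ = _ := mul_comm _ _
  · have h1 : expRpowConv σ ε (deriv w) x ^ 2 ≤ (E * (x - R)⁻¹) ^ 2 :=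
      sq_le_sq.2 ((abs_expRpowConv_deriv_le hσ hσ1 hε hw hR hA hR0 h'.le).trans (le_abs_self _))
    have hxR : 1 < x - R := by linarith
    have h2 : 1 + x ^ 2 ≤ (1 + (R + 1) ^ 2) * (x - R) ^ 2 := by
      obtain ⟨d, rfl⟩ : ∃ d, x = d + R := ⟨x - R, by ring⟩
      have hd : 1 ≤ d := by linarith
      have : d + R ≤ d * (R + 1) := by nlinarith
      have h3 : (d + R) ^ 2 ≤ (d * (R + 1)) ^ 2 := by gcongr
      rw [add_sub_cancel_right]
      nlinarith
    calc _ ≤ (E * (x - R)⁻¹) ^ 2 * ((1 + (R + 1) ^ 2) * (x - R) ^ 2) := by gcongr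
      _ = (1 + (R + 1) ^ 2) * E ^ 2 := by
          have : x - R ≠ 0 := by linarith
          field_simp
      _ ≤ _ := by
          gcongr
          linarith [sq_nonneg D]

theorem integral_expRpowConv_deriv_mul {σ : ℝ} (hσ : 0 < σ) (hσ1 : σ ≤ 1) {w : ℝ → ℝ}
    (hw : ContDiff ℝ (⊤ : ℕ∞) w) (hcw : HasCompactSupport w) :
    ∫ x, expRpowConv σ 0 (deriv w) x * expRpowConv σ 0 (fun y => deriv w (-y)) (-x) =
      Real.cos (Real.pi * σ) * ∫ x, expRpowConv σ 0 (deriv w) x ^ 2 := by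
  have hw1 : ContDiff ℝ 1 w := hw.of_le (by exact_mod_cast le_top)
  have hv : Continuous (deriv w) := hw1.continuous_deriv le_rfl
  have hcv : HasCompactSupport (deriv w) := hcw.deriv
  have hv' : Continuous fun y => deriv w (-y) := by fun_prop
  have hcv' : HasCompactSupport fun y => deriv w (-y) := hcv.comp_homeomorph (Homeomorph.neg ℝ)
  obtain ⟨hV, hlim⟩ := tendsto_integral_re_sq_cpow_sub hσ hσ1 hw hcw
  obtain ⟨C, hC⟩ := exists_sq_expRpowConv_deriv_le hσ hσ1 hw1 hcw
  obtain ⟨C', hC'⟩ : ∃ C, ∀ ε, 0 ≤ ε → ∀ x,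
      expRpowConv σ ε (fun y => deriv w (-y)) x ^ 2 ≤ C * (1 + x ^ 2)⁻¹ := by
    have hd : (fun y => deriv w (-y)) = deriv fun y => -w (-y) := by
      ext y
      rw [deriv.fun_neg, deriv_comp_neg, neg_neg]
    rw [hd]
    exact exists_sq_expRpowConv_deriv_le hσ hσ1 (hw1.comp contDiff_neg).neg
      (HasCompactSupport.neg (hcw.comp_homeomorph (Homeomorph.neg ℝ)))
  have hpos : ∀ᶠ ε : ℝ in 𝓝[>] 0, 0 < ε := self_mem_nhdsWithin
  have hP : Tendsto (fun ε => ∫ x, expRpowConv σ ε (deriv w) x ^ 2) (𝓝[>] 0)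
      (𝓝 (∫ x, expRpowConv σ 0 (deriv w) x ^ 2)) := by
    refine tendsto_integral_filter_of_dominated_convergence (fun x => C * (1 + x ^ 2)⁻¹) ?_ ?_
      (integrable_inv_one_add_sq.const_mul C)
      (ae_of_all _ fun x => (tendsto_expRpowConv hσ hv hcv x).pow 2)
    · filter_upwards [hpos] with ε hε
      exact ((continuous_expRpowConv hσ hε hv hcv).pow 2).aestronglyMeasurable
    · filter_upwards [hpos] with ε hε
      refine ae_of_all _ fun x => ?_
      rw [Real.norm_of_nonneg (sq_nonneg _)]
      exact hC ε hε.le x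
  have hQ : Tendsto (fun ε => ∫ x,
      expRpowConv σ ε (deriv w) x * expRpowConv σ ε (fun y => deriv w (-y)) (-x)) (𝓝[>] 0)
      (𝓝 (∫ x, expRpowConv σ 0 (deriv w) x * expRpowConv σ 0 (fun y => deriv w (-y)) (-x))) := by
    refine tendsto_integral_filter_of_dominated_convergence
      (fun x => (C + C') * (1 + x ^ 2)⁻¹) ?_ ?_ (integrable_inv_one_add_sq.const_mul _)
      (ae_of_all _ fun x => (tendsto_expRpowConv hσ hv hcv x).mul
        (tendsto_expRpowConv hσ hv' hcv' (-x)))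
    · filter_upwards [hpos] with ε hε
      exact ((continuous_expRpowConv hσ hε hv hcv).mul
        ((continuous_expRpowConv hσ hε hv' hcv').comp continuous_neg)).aestronglyMeasurable
    · filter_upwards [hpos] with ε hε
      refine ae_of_all _ fun x => ?_
      have h1 := hC ε hε.le x
      have h2 := hC' ε hε.le (-x)
      rw [neg_sq] at h2
      rw [Real.norm_eq_abs, abs_le]
      constructor <;> nlinarith [sq_nonneg (expRpowConv σ ε (deriv w) x +
        expRpowConv σ ε (fun y => deriv w (-y)) (-x)), sq_nonneg (expRpowConv σ ε (deriv w) x -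
        expRpowConv σ ε (fun y => deriv w (-y)) (-x)), sq_nonneg (expRpowConv σ ε (deriv w) x),
        sq_nonneg (expRpowConv σ ε (fun y => deriv w (-y)) (-x))]
  have hdiff := hQ.sub (hP.const_mul (Real.cos (Real.pi * σ)))
  have hlim' := hlim.const_mul (Real.Gamma σ ^ 2)
  rw [mul_zero] at hlim'
  refine sub_eq_zero.1 (tendsto_nhds_unique hdiff (hlim'.congr' ?_))
  filter_upwards [hpos] with ε hε
  exact (integral_expRpowConv_mul_sub hσ hε hv hcv hV _).symm

theorem expRpowConv_zero_eq_setIntegral (σ : ℝ) (v : ℝ → ℝ) (x : ℝ) :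
    expRpowConv σ 0 v x = ∫ t in Ioi 0, t ^ (σ - 1) * v (x - t) := by
  rw [expRpowConv, ← integral_indicator measurableSet_Ioi]
  refine integral_congr_ae (ae_of_all _ fun t => ?_)
  rcases le_or_gt t 0 with ht | ht
  · simp [expRpowKernel_of_nonpos _ _ ht, ht]
  · simp [expRpowKernel_of_pos _ _ ht, ht]

theorem setIntegral_Iic_rpow_mul (σ : ℝ) (v : ℝ → ℝ) (x : ℝ) :
    ∫ t in Iic x, (x - t) ^ (σ - 1) * v t = expRpowConv σ 0 v x := by
  rw [expRpowConv_zero_eq_setIntegral, integral_Iic_eq_integral_Iio,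
    ← integral_indicator measurableSet_Ioi, ← integral_indicator measurableSet_Iio,
    ← integral_sub_left_eq_self _ volume x]
  refine integral_congr_ae (ae_of_all _ fun t => ?_)
  simp [indicator_apply]

theorem setIntegral_Ici_rpow_mul (σ : ℝ) (v : ℝ → ℝ) (x : ℝ) :
    ∫ t in Ici x, (t - x) ^ (σ - 1) * v t = expRpowConv σ 0 (fun y => v (-y)) (-x) := by
  rw [expRpowConv_zero_eq_setIntegral, integral_Ici_eq_integral_Ioi,
    ← integral_indicator measurableSet_Ioi, ← integral_indicator measurableSet_Ioi,
    ← integral_add_right_eq_self _ x]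
  refine integral_congr_ae (ae_of_all _ fun t => ?_)
  simp [indicator_apply, add_comm]

theorem iteratedDeriv_expRpowConv_zero {σ : ℝ} (hσ : 0 < σ) {u : ℝ → ℝ}
    (hu : ContDiff ℝ (⊤ : ℕ∞) u) (hcu : HasCompactSupport u) (n : ℕ) :
    iteratedDeriv n (expRpowConv σ 0 u) = expRpowConv σ 0 (iteratedDeriv n u) := by
  induction n generalizing u with
  | zero => simp
  | succ n ih =>
    have h : deriv (expRpowConv σ 0 u) = expRpowConv σ 0 (deriv u) :=
      funext fun x => (hcu.hasDerivAt_convolution_right (ContinuousLinearMap.mul ℝ ℝ)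
        (locallyIntegrable_expRpowKernel_zero hσ) (hu.of_le (by exact_mod_cast le_top)) x).deriv
    rw [iteratedDeriv_succ', iteratedDeriv_succ', h, ih _ hcu.deriv]
    exact (contDiff_infty_iff_deriv.1 hu).2

theorem leftFracDeriv_eq {μ : ℝ} {n : ℕ} (hμ : μ < n) {u : ℝ → ℝ}
    (hu : ContDiff ℝ (⊤ : ℕ∞) u) (hcu : HasCompactSupport u) (x : ℝ) :
    leftFracDeriv μ n u x =
      1 / Real.Gamma (n - μ) * expRpowConv (n - μ) 0 (iteratedDeriv n u) x := by
  rw [leftFracDeriv]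
  simp only [setIntegral_Iic_rpow_mul]
  rw [iteratedDeriv_const_mul_field, iteratedDeriv_expRpowConv_zero (sub_pos.2 hμ) hu hcu]

theorem rightFracDeriv_eq {μ : ℝ} {n : ℕ} (hμ : μ < n) {u : ℝ → ℝ}
    (hu : ContDiff ℝ (⊤ : ℕ∞) u) (hcu : HasCompactSupport u) (x : ℝ) :
    rightFracDeriv μ n u x = 1 / Real.Gamma (n - μ) * ((-1) ^ n *
      expRpowConv (n - μ) 0 (fun y => iteratedDeriv n u (-y)) (-x)) := by
  have h : iteratedDeriv n (fun y => u (-y)) = fun y => (-1) ^ n * iteratedDeriv n u (-y) :=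
    funext fun y => iteratedDeriv_comp_neg n u y
  have hc (v : ℝ → ℝ) (c y : ℝ) : expRpowConv (n - μ) 0 (fun z => c * v z) y =
      c * expRpowConv (n - μ) 0 v y := by
    simp only [expRpowConv, mul_left_comm, integral_const_mul]
  rw [rightFracDeriv]
  simp only [setIntegral_Ici_rpow_mul]
  rw [iteratedDeriv_const_mul_field, iteratedDeriv_comp_neg,
    iteratedDeriv_expRpowConv_zero (u := fun y => u (-y)) (sub_pos.2 hμ) (hu.comp contDiff_neg)
      (hcu.comp_homeomorph (Homeomorph.neg ℝ)), h, hc, smul_eq_mul]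
  have h1 : ((-1 : ℝ) ^ n) * (-1) ^ n = 1 := by rw [← mul_pow]; simp
  linear_combination (1 / Real.Gamma (n - μ) * (-1) ^ n *
    expRpowConv (n - μ) 0 (fun y => iteratedDeriv n u (-y)) (-x)) * h1

theorem sq_L2normR (u : ℝ → ℝ) : L2normR u ^ 2 = ∫ x, u x ^ 2 := by
  rw [L2normR, ← Real.sqrt_eq_rpow, Real.sq_sqrt (integral_nonneg fun _ => sq_nonneg _)]

theorem L2normR_nonneg (u : ℝ → ℝ) : 0 ≤ L2normR u :=
  Real.rpow_nonneg (integral_nonneg fun _ => sq_nonneg _) _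

theorem integral_leftFracDeriv_mul_rightFracDeriv {μ : ℝ} (hμ : 0 < μ) {n : ℕ}
    (hn1 : (n : ℝ) - 1 ≤ μ) (hn2 : μ < n) {u : ℝ → ℝ} (hu : ContDiff ℝ (⊤ : ℕ∞) u)
    (hcu : HasCompactSupport u) :
    ∫ x : ℝ, leftFracDeriv μ n u x * rightFracDeriv μ n u x =
      Real.cos (Real.pi * μ) * (L2normR (leftFracDeriv μ n u)) ^ 2 := by
  obtain ⟨m, rfl⟩ : ∃ m, n = m + 1 :=
    Nat.exists_eq_succ_of_ne_zero fun h => by simp [h] at hn2; linarith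
  have hw : ContDiff ℝ (⊤ : ℕ∞) (iteratedDeriv m u) := by
    rw [iteratedDeriv_eq_iterate]
    exact hu.iterate_deriv m
  have hcw : HasCompactSupport (iteratedDeriv m u) := by
    rw [iteratedDeriv_eq_iterate]
    exact Function.Iterate.rec _ hcu (fun _ hg => hg.deriv) m
  have hcore := integral_expRpowConv_deriv_mul (sub_pos.2 hn2) (by linarith) hw hcw
  rw [← iteratedDeriv_succ] at hcore
  have hcos : Real.cos (Real.pi * μ) =
      (-1) ^ (m + 1) * Real.cos (Real.pi * (((m + 1 : ℕ) : ℝ) - μ)) := by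
    rw [show Real.pi * (((m + 1 : ℕ) : ℝ) - μ) = ((m + 1 : ℕ) : ℝ) * Real.pi - Real.pi * μ by ring,
      Real.cos_nat_mul_pi_sub, ← mul_assoc, ← mul_pow]
    simp
  simp only [sq_L2normR, leftFracDeriv_eq hn2 hu hcu, rightFracDeriv_eq hn2 hu hcu, mul_pow,
    integral_const_mul]
  rw [hcos]
  set G := 1 / Real.Gamma (((m + 1 : ℕ) : ℝ) - μ)
  calc _ = G ^ 2 * (-1) ^ (m + 1) * ∫ x, expRpowConv (((m + 1 : ℕ) : ℝ) - μ) 0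
        (iteratedDeriv (m + 1) u) x * expRpowConv (((m + 1 : ℕ) : ℝ) - μ) 0
          (fun y => iteratedDeriv (m + 1) u (-y)) (-x) := by
        rw [← integral_const_mul]
        congr 1
        ext x
        ring
    _ = _ := by
        rw [hcore]
        ring

theorem cos_pi_mul_ne_zero {μ : ℝ} {n : ℕ} (hn1 : (n : ℝ) - 1 ≤ μ) (hn2 : μ < n)
    (h : μ ≠ (n : ℝ) - 1 / 2) : Real.cos (Real.pi * μ) ≠ 0 := by
  intro h0
  obtain ⟨k, hk⟩ := Real.cos_eq_zero_iff.1 h0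
  have hk' : μ = k + 1 / 2 := by
    refine mul_left_cancel₀ Real.pi_ne_zero (hk.trans ?_)
    ring
  have h1 : k < n := by exact_mod_cast (by linarith : (k : ℝ) < n)
  have h2 : (n : ℤ) - 2 < k := by exact_mod_cast (by linarith : (n : ℝ) - 2 < k)
  have h3 : k = (n : ℤ) - 1 := by omega
  apply h
  rw [hk', h3]
  push_cast
  ring

end

/-- `∫_ℝ (D^μ u)(D^{μ*} u) dx = cos(πμ) ‖D^μ u‖²_{L²}` on `C₀^∞(ℝ)`; consequently, for
`μ ≠ n - 1/2` the symmetric and left fractional derivative semi-norms are equivalent. -/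
theorem symmetric_fracDeriv_seminorm_equiv (μ : ℝ) (hμ : 0 < μ) (n : ℕ)
    (hn1 : (n : ℝ) - 1 ≤ μ) (hn2 : μ < n) :
    (∀ u : ℝ → ℝ, ContDiff ℝ (⊤ : ℕ∞) u → HasCompactSupport u →
      ∫ x : ℝ, leftFracDeriv μ n u x * rightFracDeriv μ n u x
        = Real.cos (Real.pi * μ) * (L2normR (leftFracDeriv μ n u)) ^ 2) ∧
    (μ ≠ (n : ℝ) - 1/2 →
      ∃ C₁ C₂ : ℝ, 0 < C₁ ∧ 0 < C₂ ∧
        ∀ u : ℝ → ℝ, ContDiff ℝ (⊤ : ℕ∞) u → HasCompactSupport u →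
          C₁ * L2normR (leftFracDeriv μ n u)
              ≤ |∫ x : ℝ, leftFracDeriv μ n u x * rightFracDeriv μ n u x| ^ ((1:ℝ)/2) ∧
          |∫ x : ℝ, leftFracDeriv μ n u x * rightFracDeriv μ n u x| ^ ((1:ℝ)/2)
              ≤ C₂ * L2normR (leftFracDeriv μ n u)) := by
  have key {u : ℝ → ℝ} (hu : ContDiff ℝ (⊤ : ℕ∞) u) (hcu : HasCompactSupport u) :=
    integral_leftFracDeriv_mul_rightFracDeriv hμ hn1 hn2 hu hcu
  refine ⟨fun u hu hcu => key hu hcu, fun hne => ?_⟩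
  have hpos : 0 < |Real.cos (Real.pi * μ)| ^ ((1 : ℝ) / 2) :=
    Real.rpow_pos_of_pos (abs_pos.2 (cos_pi_mul_ne_zero hn1 hn2 hne)) _
  refine ⟨_, _, hpos, hpos, fun u hu hcu => ?_⟩
  have h : |∫ x : ℝ, leftFracDeriv μ n u x * rightFracDeriv μ n u x| ^ ((1 : ℝ) / 2) =
      |Real.cos (Real.pi * μ)| ^ ((1 : ℝ) / 2) * L2normR (leftFracDeriv μ n u) := by
    rw [key hu hcu, abs_mul, abs_of_nonneg (sq_nonneg (L2normR _)),
      Real.mul_rpow (abs_nonneg _) (sq_nonneg _), ← Real.sqrt_eq_rpow (L2normR _ ^ 2),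
      Real.sqrt_sq (L2normR_nonneg _)]
  exact ⟨h.ge, h.le⟩
end
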